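/- arXiv:2302.06408 — 2 statements merged into one kernel-verified Lean document; each statement's English description precedes it below -/
import Mathlib

section
/- There exists an orientation-preserving homeomorphism h : S¹ → S¹ which is absolutely continuous with h'(θ) > 0 for almost every θ and E(log h') < ∞ (so h is a Weil–Petersson class quasisymmetric homeomorphism by Shen's characterization), but such that h is not Lipschitz (its lift H is not a Lipschitz function on ℝ) and h does not belong to H^{3/2}(S¹), i.e., the Ḣ^{1/2}(S¹) seminorm of h' is infinite (Shen). -/
/-!
STATEMENT 11 (Shen): there exists a Weil–Petersson class quasisymmetric homeomorphism `h` of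
the circle (absolutely continuous with `h' > 0` a.e. and `E(log h') < ∞`) which is neither
Lipschitz nor in `H^{3/2}(S¹)` (the `Ḣ^{1/2}(S¹)` seminorm of `h'` is infinite).
-/

open MeasureTheory Metric Real

/-- Douglas energy of a `2π`-periodic function of the angle: the `Ḣ^{1/2}(S¹)` seminorm
`∬ |u(θ)−u(σ)|²/|e^{iθ}−e^{iσ}|² dθ dσ` over one period in each variable. -/
noncomputable def douglasEnergyP (u : ℝ → ℂ) : ENNReal :=
  ∫⁻ θ in Set.Ioc 0 (2 * π), ∫⁻ σ in Set.Ioc 0 (2 * π),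
    ENNReal.ofReal
      (‖u θ - u σ‖ ^ 2 / ‖Complex.exp (θ * Complex.I) - Complex.exp (σ * Complex.I)‖ ^ 2)

/-- The homogeneous `Ḣ^s(S¹)` seminorm (squared) of a `2π`-periodic function of the angle. -/
noncomputable def sobolevSeminorm (s : ℝ) (u : ℝ → ℂ) : ENNReal :=
  ∫⁻ θ in Set.Ioc 0 (2 * π), ∫⁻ σ in Set.Ioc 0 (2 * π),
    ENNReal.ofReal
      (‖u θ - u σ‖ ^ 2 /
        ‖Complex.exp (θ * Complex.I) - Complex.exp (σ * Complex.I)‖ ^ (1 + 2 * s))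

/-- The distance from `θ` to `2πℤ`, i.e. the length of the shortest arc from `e^{iθ}` to `1`. -/
noncomputable def foldedAngle (θ : ℝ) : ℝ := ‖(θ : AddCircle (2 * π))‖

/-- The profile of the density on `(0, π]`. -/
noncomputable def logProfile (t : ℝ) : ℝ := (1 + log π - log t) / 2

lemma foldedAngle_nonneg (θ : ℝ) : 0 ≤ foldedAngle θ := norm_nonneg _

lemma foldedAngle_le_pi (θ : ℝ) : foldedAngle θ ≤ π := by
  have h := AddCircle.norm_le_half_period (2 * π) (x := (θ : AddCircle (2 * π))) (by positivity)
  rw [abs_of_pos (by positivity)] at h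
  unfold foldedAngle
  linarith

lemma foldedAngle_of_mem_Icc {θ : ℝ} (h : θ ∈ Set.Icc 0 π) : foldedAngle θ = θ := by
  have := (AddCircle.norm_coe_eq_abs_iff (2 * π) (x := θ) (by positivity)).2 (by
    rw [abs_of_nonneg h.1, abs_of_pos (by positivity)]
    linarith [h.2])
  rw [foldedAngle, this, abs_of_nonneg h.1]

lemma foldedAngle_add_two_pi (θ : ℝ) : foldedAngle (θ + 2 * π) = foldedAngle θ := by
  simp [foldedAngle]

lemma foldedAngle_two_pi_sub (θ : ℝ) : foldedAngle (2 * π - θ) = foldedAngle θ := by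
  simp only [foldedAngle, AddCircle.coe_sub, AddCircle.coe_period, zero_sub, norm_neg]

lemma measurable_foldedAngle : Measurable foldedAngle :=
  (continuous_norm.comp (AddCircle.continuous_mk' (2 * π))).measurable

lemma foldedAngle_pos {θ : ℝ} (h : θ ∈ Set.Ioo 0 (2 * π)) : 0 < foldedAngle θ := by
  rcases le_total θ π with h' | h'
  · rw [foldedAngle_of_mem_Icc ⟨h.1.le, h'⟩]
    exact h.1
  · rw [← foldedAngle_two_pi_sub, foldedAngle_of_mem_Icc ⟨by linarith [h.2], by linarith⟩]
    linarith [h.2]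

lemma foldedAngle_le_abs (θ : ℝ) : foldedAngle θ ≤ |θ| := by
  simpa [foldedAngle] using
    QuotientAddGroup.norm_mk_le_norm (S := AddSubgroup.zmultiples (2 * π)) (m := θ)

lemma abs_foldedAngle_sub_le (θ σ : ℝ) :
    |foldedAngle θ - foldedAngle σ| ≤
      π / 2 * ‖Complex.exp (θ * Complex.I) - Complex.exp (σ * Complex.I)‖ := by
  have hmod : foldedAngle (θ - σ) ≤ |toIocMod Real.two_pi_pos (-π) (θ - σ)| := by
    refine le_trans (le_of_eq ?_) (foldedAngle_le_abs _)
    exact (Function.Periodic.sub_zsmul_eq foldedAngle_add_two_pi _).symm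
  rw [← Complex.angle_exp_exp] at hmod
  calc |foldedAngle θ - foldedAngle σ| ≤ foldedAngle (θ - σ) := by
        simpa [foldedAngle] using
          abs_norm_sub_norm_le (θ : AddCircle (2 * π)) (σ : AddCircle (2 * π))
    _ ≤ _ := hmod
    _ ≤ _ := Complex.angle_le_mul_norm_sub (Complex.norm_exp_ofReal_mul_I θ)
        (Complex.norm_exp_ofReal_mul_I σ)

lemma norm_exp_sub_exp_le (θ σ : ℝ) :
    ‖Complex.exp (θ * Complex.I) - Complex.exp (σ * Complex.I)‖ ≤ |θ - σ| := by
  have h := Real.norm_exp_I_mul_ofReal_sub_one_le (x := θ - σ)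
  have hfac : Complex.exp (θ * Complex.I) - Complex.exp (σ * Complex.I) =
      Complex.exp (σ * Complex.I) * (Complex.exp (Complex.I * (θ - σ : ℝ)) - 1) := by
    rw [mul_sub, ← Complex.exp_add, mul_one]
    congr 2
    push_cast
    ring
  rwa [hfac, norm_mul, Complex.norm_exp_ofReal_mul_I, one_mul]

lemma half_le_logProfile {t : ℝ} (h0 : 0 ≤ t) (h : t ≤ π) : 1 / 2 ≤ logProfile t := by
  unfold logProfile
  rcases h0.eq_or_lt with rfl | h0
  · have := log_nonneg (x := π) (by linarith [pi_gt_three])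
    simp only [log_zero]
    linarith
  · linarith [log_le_log h0 h]

lemma logProfile_foldedAngle_pos (θ : ℝ) : 0 < logProfile (foldedAngle θ) := by
  linarith [half_le_logProfile (foldedAngle_nonneg θ) (foldedAngle_le_pi θ)]

lemma measurable_logProfile : Measurable logProfile := by
  unfold logProfile
  fun_prop

lemma lintegral_comp_foldedAngle (f : ℝ → ENNReal) :
    ∫⁻ θ in Set.Ioo 0 (2 * π), f (foldedAngle θ) = 2 * ∫⁻ t in Set.Ioc 0 π, f t := by
  have hpi := pi_pos
  have hsplit : Set.Ioo 0 (2 * π) = Set.Ioc 0 π ∪ Set.Ioo π (2 * π) :=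
    (Set.Ioc_union_Ioo_eq_Ioo hpi.le (by linarith)).symm
  rw [hsplit, lintegral_union measurableSet_Ioo
    (Set.disjoint_left.2 fun x hx hx' => not_lt.2 hx.2 hx'.1), two_mul (lintegral _ _)]
  congr 1
  · exact setLIntegral_congr_fun measurableSet_Ioc fun t ht => by
      simp only [foldedAngle_of_mem_Icc ⟨ht.1.le, ht.2⟩]
  · have hpre : (fun x : ℝ => 2 * π - x) ⁻¹' Set.Ioo 0 π = Set.Ioo π (2 * π) := by
      ext x
      simp only [Set.mem_preimage, Set.mem_Ioo]
      constructor <;> rintro ⟨h1, h2⟩ <;> constructor <;> linarith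
    have hmp := (Measure.measurePreserving_sub_left (volume : Measure ℝ) (2 * π))
    rw [← restrict_Ioo_eq_restrict_Ioc, ← hmp.setLIntegral_comp_preimage_emb
      (MeasurableEquiv.subLeft (2 * π)).measurableEmbedding f (Set.Ioo 0 π), hpre]
    refine setLIntegral_congr_fun measurableSet_Ioo fun x hx => ?_
    rw [← foldedAngle_two_pi_sub, foldedAngle_of_mem_Icc]
    exact ⟨by linarith [hx.2], by linarith [hx.1]⟩

/-- Majorant of the energy density of `log ∘ logProfile` on the region `b ≤ a`. -/
noncomputable def energyMajorant (a b : ℝ) : ENNReal :=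
  if b ≤ a then ENNReal.ofReal (π ^ 2 / (a * √a * logProfile a ^ 2)) * ENNReal.ofReal (1 / √b)
  else 0

lemma measurable_energyMajorant : Measurable (Function.uncurry energyMajorant) := by
  have := measurable_logProfile
  unfold energyMajorant Function.uncurry
  refine Measurable.ite (measurableSet_le measurable_snd measurable_fst) ?_ measurable_const
  fun_prop

lemma log_div_le {a b : ℝ} (hb : 0 < b) (hab : b ≤ a) :
    log (a / b) ^ 2 ≤ 16 * (a - b) ^ 2 / (√b * (a * √a)) := by
  have ha : 0 < a := hb.trans_le hab
  obtain ⟨R, hR, rfl⟩ : ∃ R : ℝ, 0 < R ∧ R ^ 4 = a :=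
    ⟨√√a, by positivity, by
      rw [show (4 : ℕ) = 2 * 2 from rfl, pow_mul, sq_sqrt (by positivity), sq_sqrt ha.le]⟩
  obtain ⟨r, hr, rfl⟩ : ∃ r : ℝ, 0 < r ∧ r ^ 4 = b :=
    ⟨√√b, by positivity, by
      rw [show (4 : ℕ) = 2 * 2 from rfl, pow_mul, sq_sqrt (by positivity), sq_sqrt hb.le]⟩
  have hrR : r ≤ R := le_of_pow_le_pow_left₀ (by norm_num) hR.le hab
  have hsqrt : ∀ x : ℝ, √(x ^ 4) = x ^ 2 := fun x => by
    rw [show x ^ 4 = (x ^ 2) ^ 2 by ring, sqrt_sq (by positivity)]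
  have h1 : 0 ≤ log (R ^ 4 / r ^ 4) := log_nonneg ((one_le_div hb).2 hab)
  have h2 : log (R ^ 4 / r ^ 4) ≤ 4 * (R ^ 4 - r ^ 4) / (r * R ^ 3) := by
    rw [← div_pow, log_pow]
    have hlog := log_le_sub_one_of_pos (show 0 < R / r by positivity)
    have hkey : R / r - 1 ≤ (R ^ 4 - r ^ 4) / (r * R ^ 3) := by
      rw [div_sub_one hr.ne', div_le_div_iff₀ hr (by positivity)]
      have : 0 ≤ r ^ 2 * (R ^ 3 - r ^ 3) :=
        mul_nonneg (by positivity) (sub_nonneg.2 (pow_le_pow_left₀ hr.le hrR 3))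
      nlinarith
    push_cast
    rw [mul_div_assoc]
    linarith
  calc log (R ^ 4 / r ^ 4) ^ 2 ≤ (4 * (R ^ 4 - r ^ 4) / (r * R ^ 3)) ^ 2 :=
        pow_le_pow_left₀ h1 h2 2
    _ = _ := by
        rw [hsqrt, hsqrt]
        field_simp
        ring

lemma sq_log_logProfile_sub_div_le {a b D : ℝ} (hb : 0 < b) (hab : b ≤ a) (ha : a ≤ π)
    (habD : a - b ≤ π / 2 * D) :
    (log (logProfile a) - log (logProfile b)) ^ 2 / D ^ 2 ≤
      π ^ 2 / (a * √a * logProfile a ^ 2) * (1 / √b) := by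
  have ha0 : 0 < a := hb.trans_le hab
  have hA : 0 < logProfile a := by linarith [half_le_logProfile ha0.le ha]
  have hB : 0 < logProfile b := by linarith [half_le_logProfile hb.le (hab.trans ha)]
  have hdiff : logProfile b - logProfile a = log (a / b) / 2 := by
    rw [log_div ha0.ne' hb.ne']
    unfold logProfile
    ring
  have hlog0 : 0 ≤ log (a / b) := log_nonneg ((one_le_div hb).2 hab)
  have h0 : 0 ≤ log (logProfile b) - log (logProfile a) :=
    sub_nonneg.2 (log_le_log hA (by linarith))
  have h1 : log (logProfile b) - log (logProfile a) ≤ log (a / b) / (2 * logProfile a) := by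
    rw [← log_div hB.ne' hA.ne']
    refine (log_le_sub_one_of_pos (by positivity)).trans (le_of_eq ?_)
    rw [div_sub_one hA.ne', hdiff]
    field_simp
  have h2 : (log (logProfile a) - log (logProfile b)) ^ 2 ≤
      (16 * (a - b) ^ 2 / (√b * (a * √a))) / (2 * logProfile a) ^ 2 := by
    calc _ = (log (logProfile b) - log (logProfile a)) ^ 2 := by ring
      _ ≤ (log (a / b) / (2 * logProfile a)) ^ 2 := pow_le_pow_left₀ h0 h1 2
      _ = log (a / b) ^ 2 / (2 * logProfile a) ^ 2 := by rw [div_pow]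
      _ ≤ _ := by gcongr; exact log_div_le hb hab
  refine div_le_of_le_mul₀ (by positivity) (by positivity) (h2.trans ?_)
  calc _ ≤ (16 * (π / 2 * D) ^ 2 / (√b * (a * √a))) / (2 * logProfile a) ^ 2 := by
        gcongr
    _ = _ := by
        field_simp
        ring

lemma lintegral_energyMajorant_le {a : ℝ} (ha : 0 < a) (ha' : a ≤ π) :
    ∫⁻ b in Set.Ioc 0 π, energyMajorant a b ≤
      ENNReal.ofReal (2 * π ^ 2 * (a⁻¹ / logProfile a ^ 2)) := by
  have hint : IntervalIntegrable (fun x : ℝ => 1 / √x) volume 0 a := by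
    refine (intervalIntegral.intervalIntegrable_rpow' (r := -1 / 2) (by norm_num)).congr ?_
    intro x hx
    rw [Set.uIoc_of_le ha.le] at hx
    simp only
    rw [sqrt_eq_rpow, neg_div, rpow_neg hx.1.le, one_div (x ^ _)]
  have hval : ∫ x in (0 : ℝ)..a, 1 / √x = 2 * √a := by
    have : ∫ x in (0 : ℝ)..a, 1 / √x = ∫ x in (0 : ℝ)..a, x ^ (-1 / 2 : ℝ) := by
      refine intervalIntegral.integral_congr_ae (Filter.Eventually.of_forall fun x hx => ?_)
      rw [Set.uIoc_of_le ha.le] at hx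
      rw [sqrt_eq_rpow, neg_div, rpow_neg hx.1.le, one_div (x ^ _)]
    rw [this, integral_rpow (Or.inl (by norm_num)), sqrt_eq_rpow]
    norm_num
    ring
  have hinner : ∫⁻ b in Set.Ioc 0 a, ENNReal.ofReal (1 / √b) = ENNReal.ofReal (2 * √a) := by
    rw [← hval, intervalIntegral.integral_of_le ha.le,
      ofReal_integral_eq_lintegral_ofReal
        ((intervalIntegrable_iff_integrableOn_Ioc_of_le ha.le).1 hint)
        (Filter.Eventually.of_forall fun x => by positivity)]
  have hset : ∫⁻ b in Set.Ioc 0 π, energyMajorant a b ≤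
      ∫⁻ b in Set.Ioc 0 a, ENNReal.ofReal (π ^ 2 / (a * √a * logProfile a ^ 2)) *
        ENNReal.ofReal (1 / √b) := by
    rw [← lintegral_indicator measurableSet_Ioc, ← lintegral_indicator measurableSet_Ioc]
    refine lintegral_mono fun b => ?_
    by_cases h : b ∈ Set.Ioc 0 π
    · by_cases h' : b ≤ a
      · simp [h, h', h.1, Set.indicator, energyMajorant]
      · simp [h', Set.indicator, energyMajorant]
    · simp [h]
  refine hset.trans ?_
  rw [lintegral_const_mul' _ _ ENNReal.ofReal_ne_top, hinner,
    ← ENNReal.ofReal_mul (by positivity)]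
  refine ENNReal.ofReal_le_ofReal (le_of_eq ?_)
  have : 0 < √a := sqrt_pos.2 ha
  have hA : 0 < logProfile a := by linarith [half_le_logProfile ha.le ha']
  field_simp

lemma integrableOn_inv_div_sq_logProfile :
    IntegrableOn (fun a => a⁻¹ / logProfile a ^ 2) (Set.Ioc 0 π) := by
  refine intervalIntegral.integrableOn_deriv_of_nonneg
    (g := Function.update (fun a => 2 * (logProfile a)⁻¹) 0 0) ?_ ?_ ?_
  · intro x hx
    rcases hx.1.eq_or_lt with rfl | h0
    · refine ContinuousAt.continuousWithinAt (continuousAt_update_same.2 ?_)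
      have : Filter.Tendsto logProfile (nhdsWithin 0 {0}ᶜ) Filter.atTop := by
        unfold logProfile
        refine Filter.Tendsto.atTop_div_const (by norm_num) ?_
        simp only [sub_eq_add_neg]
        exact Filter.tendsto_atTop_add_const_left _ _
          (Filter.tendsto_neg_atBot_atTop.comp tendsto_log_nhdsNE_zero)
      simpa using (this.inv_tendsto_atTop).const_mul 2
    · refine ContinuousAt.continuousWithinAt ?_
      rw [continuousAt_update_of_ne h0.ne']
      have hA : 0 < logProfile x := by linarith [half_le_logProfile h0.le hx.2]
      refine ContinuousAt.mul continuousAt_const (ContinuousAt.inv₀ ?_ hA.ne')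
      unfold logProfile
      exact (continuousAt_const.sub (continuousAt_log h0.ne')).div_const _
  · intro x hx
    have hA : 0 < logProfile x := by linarith [half_le_logProfile hx.1.le hx.2.le]
    have h1 : HasDerivAt logProfile (-x⁻¹ / 2) x := by
      unfold logProfile
      simpa using ((hasDerivAt_log hx.1.ne').const_sub (1 + log π)).div_const 2
    have h2 := (h1.inv hA.ne').const_mul 2
    have heq : (fun a => 2 * (logProfile a)⁻¹) =ᶠ[nhds x]
        Function.update (fun a => 2 * (logProfile a)⁻¹) 0 0 := by
      filter_upwards [isOpen_ne.mem_nhds hx.1.ne'] with y hy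
      rw [Function.update_of_ne hy]
    refine (h2.congr_of_eventuallyEq heq.symm).congr_deriv ?_
    field_simp
  · intro x hx
    have := inv_nonneg.2 hx.1.le
    positivity

lemma measurable_energyMajorant_foldedAngle :
    Measurable fun p : ℝ × ℝ => energyMajorant (foldedAngle p.1) (foldedAngle p.2) :=
  measurable_energyMajorant.comp ((measurable_foldedAngle.comp measurable_fst).prodMk
    (measurable_foldedAngle.comp measurable_snd))

lemma lintegral_energyMajorant_foldedAngle_lt_top :
    ∫⁻ θ in Set.Ioo 0 (2 * π), ∫⁻ σ in Set.Ioo 0 (2 * π),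
      energyMajorant (foldedAngle θ) (foldedAngle σ) < ⊤ := by
  simp only [lintegral_comp_foldedAngle (energyMajorant _)]
  rw [lintegral_comp_foldedAngle (fun a => 2 * ∫⁻ b in Set.Ioc 0 π, energyMajorant a b),
    lintegral_const_mul' _ _ (by norm_num)]
  refine ENNReal.mul_lt_top (by norm_num) (ENNReal.mul_lt_top (by norm_num) ?_)
  refine (setLIntegral_mono' measurableSet_Ioc
    fun a ha => lintegral_energyMajorant_le ha.1 ha.2).trans_lt ?_
  exact (integrableOn_inv_div_sq_logProfile.const_mul (2 * π ^ 2)).lintegral_lt_top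

lemma douglasEnergyP_log_logProfile_le :
    douglasEnergyP (fun θ => (log (logProfile (foldedAngle θ)) : ℂ)) ≤
      ∫⁻ θ in Set.Ioo 0 (2 * π), ∫⁻ σ in Set.Ioo 0 (2 * π),
        (energyMajorant (foldedAngle θ) (foldedAngle σ) +
          energyMajorant (foldedAngle σ) (foldedAngle θ)) := by
  rw [douglasEnergyP, ← restrict_Ioo_eq_restrict_Ioc]
  refine setLIntegral_mono' measurableSet_Ioo fun θ hθ =>
    setLIntegral_mono' measurableSet_Ioo fun σ hσ => ?_
  have hab := abs_le.1 (abs_foldedAngle_sub_le θ σ)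
  have hθ0 := foldedAngle_nonneg θ
  have hσ0 := foldedAngle_nonneg σ
  rw [← Complex.ofReal_sub, Complex.norm_real, norm_eq_abs, sq_abs]
  rcases le_total (foldedAngle σ) (foldedAngle θ) with h | h
  · refine le_trans ?_ le_self_add
    rw [energyMajorant, if_pos h, ← ENNReal.ofReal_mul (by positivity)]
    exact ENNReal.ofReal_le_ofReal (sq_log_logProfile_sub_div_le (foldedAngle_pos hσ) h
      (foldedAngle_le_pi _) hab.2)
  · refine le_trans ?_ le_add_self
    rw [energyMajorant, if_pos h, ← ENNReal.ofReal_mul (by positivity), ← neg_sub, neg_sq]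
    exact ENNReal.ofReal_le_ofReal (sq_log_logProfile_sub_div_le (foldedAngle_pos hθ) h
      (foldedAngle_le_pi _) (by linarith [hab.1]))

lemma douglasEnergyP_log_logProfile_lt_top :
    douglasEnergyP (fun θ => (log (logProfile (foldedAngle θ)) : ℂ)) < ⊤ := by
  have hm := measurable_energyMajorant_foldedAngle
  have hfin := lintegral_energyMajorant_foldedAngle_lt_top
  refine douglasEnergyP_log_logProfile_le.trans_lt ?_
  have hadd : ∀ θ, ∫⁻ σ in Set.Ioo 0 (2 * π), (energyMajorant (foldedAngle θ) (foldedAngle σ) +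
      energyMajorant (foldedAngle σ) (foldedAngle θ)) =
      (∫⁻ σ in Set.Ioo 0 (2 * π), energyMajorant (foldedAngle θ) (foldedAngle σ)) +
        ∫⁻ σ in Set.Ioo 0 (2 * π), energyMajorant (foldedAngle σ) (foldedAngle θ) := fun θ =>
    lintegral_add_left (hm.comp measurable_prodMk_left) _
  have hswap : ∫⁻ θ in Set.Ioo 0 (2 * π), ∫⁻ σ in Set.Ioo 0 (2 * π),
      energyMajorant (foldedAngle σ) (foldedAngle θ) =
      ∫⁻ θ in Set.Ioo 0 (2 * π), ∫⁻ σ in Set.Ioo 0 (2 * π),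
      energyMajorant (foldedAngle θ) (foldedAngle σ) :=
    lintegral_lintegral_swap (hm.comp measurable_swap).aemeasurable
  simp only [hadd]
  rw [lintegral_add_left (Measurable.lintegral_prod_right' hm), hswap]
  exact ENNReal.add_lt_top.2 ⟨hfin, hfin⟩

lemma lintegral_ofReal_const_div_eq_top {c : ℝ} (hc : 0 < c) :
    ∫⁻ θ in Set.Ioc 0 π, ENNReal.ofReal (c / θ) = ⊤ := by
  by_contra h
  have hmeas : AEStronglyMeasurable (fun θ : ℝ => c / θ) (volume.restrict (Set.Ioc 0 π)) :=
    (measurable_const.div measurable_id).aestronglyMeasurable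
  have hint : IntegrableOn (fun θ : ℝ => c / θ) (Set.Ioc 0 π) := by
    refine (lintegral_ofReal_ne_top_iff_integrable hmeas ?_).1 h
    filter_upwards [ae_restrict_mem measurableSet_Ioc] with θ hθ
    exact div_nonneg hc.le hθ.1.le
  have hinv : IntervalIntegrable (fun θ : ℝ => θ⁻¹) volume 0 π := by
    rw [intervalIntegrable_iff_integrableOn_Ioc_of_le pi_pos.le]
    refine (hint.const_mul c⁻¹).congr (Filter.Eventually.of_forall fun θ => ?_)
    simp only
    field_simp
  rcases intervalIntegrable_inv_iff.1 hinv with h | h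
  · exact pi_pos.ne h
  · exact h Set.left_mem_uIcc

lemma sobolevSeminorm_logProfile_eq_top :
    sobolevSeminorm (1 / 2) (fun θ => (logProfile (foldedAngle θ) : ℂ)) = ⊤ := by
  have hpi := pi_pos
  have hlog2 : 0 < log 2 := log_pos (by norm_num)
  rw [eq_top_iff, ← lintegral_ofReal_const_div_eq_top (c := (log 2 / 2) ^ 2 / 2) (by positivity),
    sobolevSeminorm]
  refine (setLIntegral_mono' measurableSet_Ioc fun θ hθ => ?_).trans
    (lintegral_mono_set (Set.Ioc_subset_Ioc_right (by linarith)))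
  have hsub : Set.Ioc 0 (θ / 2) ⊆ Set.Ioc 0 (2 * π) :=
    Set.Ioc_subset_Ioc_right (by linarith [hθ.2])
  refine le_trans ?_ (lintegral_mono_set hsub)
  have hconst : ENNReal.ofReal ((log 2 / 2) ^ 2 / 2 / θ) =
      ∫⁻ _ in Set.Ioc 0 (θ / 2), ENNReal.ofReal ((log 2 / 2) ^ 2 / θ ^ 2) := by
    have := hθ.1
    rw [setLIntegral_const, Real.volume_Ioc, ← ENNReal.ofReal_mul (by positivity)]
    congr 1
    field_simp
    ring
  rw [hconst]
  refine setLIntegral_mono' measurableSet_Ioc fun σ hσ => ENNReal.ofReal_le_ofReal ?_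
  have hσθ : σ < θ := by linarith [hσ.2, hθ.1]
  have hfθ := foldedAngle_of_mem_Icc ⟨hθ.1.le, hθ.2⟩
  have hfσ := foldedAngle_of_mem_Icc ⟨hσ.1.le, hσθ.le.trans hθ.2⟩
  have hD : ‖Complex.exp (θ * Complex.I) - Complex.exp (σ * Complex.I)‖ ≤ θ := by
    refine (norm_exp_sub_exp_le θ σ).trans ?_
    rw [abs_of_pos (sub_pos.2 hσθ)]
    linarith [hσ.1]
  have hD0 : 0 < ‖Complex.exp (θ * Complex.I) - Complex.exp (σ * Complex.I)‖ := by
    have h := abs_foldedAngle_sub_le θ σ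
    rw [hfθ, hfσ, abs_of_pos (sub_pos.2 hσθ)] at h
    exact pos_of_mul_pos_right ((sub_pos.2 hσθ).trans_le h) (by positivity)
  rw [show (1 + 2 * (1 / 2) : ℝ) = (2 : ℕ) by norm_num, rpow_natCast, ← Complex.ofReal_sub,
    Complex.norm_real, norm_eq_abs, sq_abs, hfθ, hfσ]
  have hnum : log 2 / 2 ≤ logProfile σ - logProfile θ := by
    have h1 : log (2 * σ) ≤ log θ := log_le_log (by linarith [hσ.1]) (by linarith [hσ.2])
    rw [log_mul (by norm_num) hσ.1.ne'] at h1
    unfold logProfile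
    linarith
  rw [← neg_sub (logProfile σ), neg_sq]
  gcongr

lemma intervalIntegrable_logProfile (a b : ℝ) : IntervalIntegrable logProfile volume a b := by
  unfold logProfile
  exact (intervalIntegrable_const.sub intervalIntegral.intervalIntegrable_log').div_const 2

lemma integral_logProfile (t : ℝ) :
    ∫ x in (0 : ℝ)..t, logProfile x = t * (2 + log π - log t) / 2 := by
  unfold logProfile
  rw [intervalIntegral.integral_div, intervalIntegral.integral_sub intervalIntegrable_const
    intervalIntegral.intervalIntegrable_log', integral_log, intervalIntegral.integral_const]
  simp only [smul_eq_mul]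
  ring

lemma integral_logProfile_foldedAngle {t : ℝ} (ht : t ∈ Set.Icc 0 π) :
    ∫ x in (0 : ℝ)..t, logProfile (foldedAngle x) = t * (2 + log π - log t) / 2 := by
  rw [← integral_logProfile]
  refine intervalIntegral.integral_congr fun x hx => ?_
  rw [Set.uIcc_of_le ht.1] at hx
  simp only [foldedAngle_of_mem_Icc ⟨hx.1, hx.2.trans ht.2⟩]

lemma periodic_logProfile_foldedAngle :
    Function.Periodic (fun θ => logProfile (foldedAngle θ)) (2 * π) := fun θ => by
  simp only [foldedAngle_add_two_pi]

lemma intervalIntegrable_logProfile_foldedAngle (a b : ℝ) :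
    IntervalIntegrable (fun θ => logProfile (foldedAngle θ)) volume a b := by
  have h1 : IntervalIntegrable (fun θ => logProfile (foldedAngle θ)) volume 0 π := by
    refine (intervalIntegrable_logProfile 0 π).congr fun x hx => ?_
    rw [Set.uIoc_of_le pi_pos.le] at hx
    simp only [foldedAngle_of_mem_Icc ⟨hx.1.le, hx.2⟩]
  have h2 := (h1.comp_sub_left (2 * π)).symm
  simp only [foldedAngle_two_pi_sub, sub_zero, show 2 * π - π = π by ring] at h2
  refine periodic_logProfile_foldedAngle.intervalIntegrable (t := 0) (by positivity) ?_ a b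
  rw [zero_add]
  exact h1.trans h2

lemma integral_logProfile_foldedAngle_period :
    ∫ x in (0 : ℝ)..2 * π, logProfile (foldedAngle x) = 2 * π := by
  have h1 := integral_logProfile_foldedAngle (t := π) ⟨pi_pos.le, le_rfl⟩
  have h2 := intervalIntegral.integral_comp_sub_left (a := 0) (b := π)
    (fun x => logProfile (foldedAngle x)) (2 * π)
  simp only [foldedAngle_two_pi_sub, sub_zero, show 2 * π - π = π by ring] at h2
  rw [← intervalIntegral.integral_add_adjacent_intervals
    (intervalIntegrable_logProfile_foldedAngle 0 π)
    (intervalIntegrable_logProfile_foldedAngle π (2 * π)), ← h2, h1]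
  ring

theorem exists_wp_class_not_lipschitz_not_Hthreehalves :
    ∃ H : ℝ → ℝ, ∃ φ : ℝ → ℝ,
      -- `H` is the lift of an orientation-preserving circle homeomorphism `h`
      Continuous H ∧ StrictMono H ∧ (∀ θ, H (θ + 2 * π) = H θ + 2 * π) ∧
      -- `h` is absolutely continuous with derivative `φ = h' > 0` a.e.
      (∀ s t : ℝ, s ≤ t → H t - H s = ∫ θ in s..t, φ θ) ∧
      (∀ᵐ θ : ℝ, 0 < φ θ) ∧
      -- `E(log h') < ∞`: `h` is of Weil–Petersson class
      douglasEnergyP (fun θ => (Real.log (φ θ) : ℂ)) < ⊤ ∧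
      -- but `h` is not Lipschitz …
      (¬ ∃ K : NNReal, LipschitzWith K H) ∧
      -- … and `h ∉ H^{3/2}(S¹)`: the `Ḣ^{1/2}` seminorm of `h'` is infinite
      sobolevSeminorm (1 / 2) (fun θ => (φ θ : ℂ)) = ⊤ := by
  have hint := intervalIntegrable_logProfile_foldedAngle
  have hsub : ∀ s t : ℝ, (∫ x in (0 : ℝ)..t, logProfile (foldedAngle x)) -
      ∫ x in (0 : ℝ)..s, logProfile (foldedAngle x) =
        ∫ x in s..t, logProfile (foldedAngle x) := fun s t =>
    intervalIntegral.integral_interval_sub_left (hint 0 t) (hint 0 s)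
  refine ⟨fun t => ∫ x in (0 : ℝ)..t, logProfile (foldedAngle x),
    fun θ => logProfile (foldedAngle θ), intervalIntegral.continuous_primitive hint 0, ?_, ?_,
    fun s t _ => hsub s t, Filter.Eventually.of_forall logProfile_foldedAngle_pos,
    douglasEnergyP_log_logProfile_lt_top, ?_, sobolevSeminorm_logProfile_eq_top⟩
  · intro s t hst
    have := intervalIntegral.intervalIntegral_pos_of_pos (hint s t) logProfile_foldedAngle_pos hst
    rw [← hsub] at this
    exact sub_pos.1 this
  · intro θ
    have := hsub θ (θ + 2 * π)
    rw [periodic_logProfile_foldedAngle.intervalIntegral_add_eq θ 0, zero_add,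
      integral_logProfile_foldedAngle_period] at this
    linarith
  · rintro ⟨K, hK⟩
    have hexp : exp (-2 * (K : ℝ)) ∈ Set.Icc 0 π := by
      refine ⟨(exp_pos _).le, ?_⟩
      have : exp (-2 * (K : ℝ)) ≤ 1 := exp_le_one_iff.2 (by linarith [K.coe_nonneg])
      linarith [pi_gt_three]
    have h := hK.dist_le_mul (exp (-2 * (K : ℝ))) 0
    rw [integral_logProfile_foldedAngle hexp, intervalIntegral.integral_same, dist_zero_right,
      dist_zero_right, norm_of_nonneg hexp.1, log_exp] at h
    have hlogpi := log_pos (x := π) (by linarith [pi_gt_three])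
    have h' := (le_norm_self _).trans h
    nlinarith [mul_pos (exp_pos (-2 * (K : ℝ))) hlogpi, exp_pos (-2 * (K : ℝ))]
end

section
/- There is a constant C > 0 such that for all continuously differentiable functions f, g : S¹ → ℂ (viewed as 2π-periodic C¹ functions of θ), |∫₀^{2π} f(e^{iθ}) · (d/dθ) g(e^{iθ}) dθ| ≤ C·√(E(f))·√(E(g)). Consequently the symplectic pairing ω(f,g) = (1/π)∫_{S¹} f dg extends to a continuous bilinear form on the homogeneous Sobolev space Ḣ^{1/2}(S¹) (Nag–Sullivan). -/
/-!
STATEMENT 12 (Nag–Sullivan): there is `C > 0` such that for all `2π`-periodic `C¹` functions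
`f, g : S¹ → ℂ`, `|∫₀^{2π} f(e^{iθ}) (d/dθ) g(e^{iθ}) dθ| ≤ C √(E(f)) √(E(g))`; hence the
symplectic pairing `ω(f,g) = (1/π)∫ f dg` extends continuously to `Ḣ^{1/2}(S¹)`.
-/

open MeasureTheory Metric Real

open scoped ComplexConjugate

/-- The `n`-th Fourier coefficient of a `2π`-periodic function of the angle. -/
noncomputable def angularCoeff (u : ℝ → ℂ) (n : ℤ) : ℂ :=
  (2 * π : ℂ)⁻¹ * ∫ θ in (0 : ℝ)..(2 * π), Complex.exp (-(n * θ * Complex.I)) * u θ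

/-- Parseval's identity for continuous `2π`-periodic functions. -/
theorem hasSum_conj_angularCoeff_mul {f g : ℝ → ℂ} (hf : Continuous f) (hg : Continuous g)
    (hfp : Function.Periodic f (2 * π)) (hgp : Function.Periodic g (2 * π)) :
    HasSum (fun n : ℤ => conj (angularCoeff f n) * angularCoeff g n)
      ((2 * π : ℂ)⁻¹ * ∫ θ in (0 : ℝ)..(2 * π), conj (f θ) * g θ) := by
  have : Fact (0 < 2 * π) := ⟨two_pi_pos⟩
  have coeff_eq (u : C(AddCircle (2 * π), ℂ)) (n : ℤ) :
      fourierCoeff u n = angularCoeff (fun θ => u θ) n := by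
    rw [fourierCoeff_eq_intervalIntegral _ _ 0, angularCoeff, zero_add, Complex.real_smul]
    congr 1
    · push_cast; simp
    · refine intervalIntegral.integral_congr fun θ _ => ?_
      simp only [fourier_coe_apply, smul_eq_mul]
      congr 2
      have : (π : ℂ) ≠ 0 := by exact_mod_cast pi_ne_zero
      push_cast
      field_simp
  let F : C(AddCircle (2 * π), ℂ) := ⟨hfp.lift, continuous_coinduced_dom.mpr hf⟩
  let G : C(AddCircle (2 * π), ℂ) := ⟨hgp.lift, continuous_coinduced_dom.mpr hg⟩
  have h := fourierBasis.hasSum_inner_mul_inner (ContinuousMap.toLp 2 AddCircle.haarAddCircle ℂ F)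
    (ContinuousMap.toLp 2 AddCircle.haarAddCircle ℂ G)
  rw [ContinuousMap.inner_toLp, AddCircle.integral_haarAddCircle,
    ← AddCircle.intervalIntegral_preimage (2 * π) 0] at h
  convert! h using 1
  · ext n
    rw [← inner_conj_symm, ← HilbertBasis.repr_apply_apply, ← HilbertBasis.repr_apply_apply,
      fourierBasis_repr, fourierBasis_repr, fourierCoeff_toLp, fourierCoeff_toLp, coeff_eq, coeff_eq]
    rfl
  · rw [zero_add, Complex.real_smul]
    push_cast
    congr 1
    refine intervalIntegral.integral_congr fun θ _ => ?_
    exact mul_comm _ _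

/-- Parseval's identity in extended nonnegative form. -/
theorem tsum_ofReal_norm_angularCoeff_sq {u : ℝ → ℂ} (hu : Continuous u)
    (hup : Function.Periodic u (2 * π)) :
    ∑' n : ℤ, ENNReal.ofReal (‖angularCoeff u n‖ ^ 2) =
      ENNReal.ofReal ((2 * π)⁻¹) * ∫⁻ θ in Set.Ioc 0 (2 * π), ENNReal.ofReal (‖u θ‖ ^ 2) := by
  have h := hasSum_conj_angularCoeff_mul hu hu hup hup
  simp only [Complex.conj_mul'] at h
  have h2 : HasSum (fun n : ℤ => ‖angularCoeff u n‖ ^ 2)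
      ((2 * π)⁻¹ * ∫ θ in (0 : ℝ)..(2 * π), ‖u θ‖ ^ 2) := by
    rw [← Complex.hasSum_ofReal]
    push_cast
    rw [← intervalIntegral.integral_ofReal]
    push_cast
    exact h
  rw [← ENNReal.ofReal_tsum_of_nonneg (fun _ => by positivity) h2.summable, h2.tsum_eq,
    ENNReal.ofReal_mul (by positivity), intervalIntegral.integral_of_le two_pi_pos.le,
    ofReal_integral_eq_lintegral_ofReal]
  · exact (Continuous.integrableOn_Icc (by fun_prop)).mono_set Set.Ioc_subset_Icc_self
  · exact .of_forall fun _ => by positivity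

theorem angularCoeff_comp_add {u : ℝ → ℂ} (hup : Function.Periodic u (2 * π)) (t : ℝ) (n : ℤ) :
    angularCoeff (fun θ => u (θ + t)) n = Complex.exp (n * t * Complex.I) * angularCoeff u n := by
  have hp : Function.Periodic
      (fun θ : ℝ => Complex.exp (-(n * θ * Complex.I)) * u θ) (2 * π) := by
    intro θ
    dsimp only
    rw [hup θ]
    congr 1
    rw [Complex.exp_eq_exp_iff_exists_int]
    exact ⟨-n, by push_cast; ring⟩
  have h := hp.intervalIntegral_add_eq t 0
  have hs := intervalIntegral.integral_comp_add_right (a := 0) (b := 2 * π)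
    (fun θ : ℝ => Complex.exp (-(n * θ * Complex.I)) * u θ) t
  rw [zero_add, add_comm (2 * π) t, h, zero_add] at hs
  rw [angularCoeff, angularCoeff, ← hs, mul_left_comm,
    ← intervalIntegral.integral_const_mul (Complex.exp (n * t * Complex.I))]
  congr 1
  refine intervalIntegral.integral_congr fun θ _ => ?_
  rw [← mul_assoc, ← Complex.exp_add]
  congr 2
  push_cast
  ring

theorem angularCoeff_sub {u v : ℝ → ℂ} (hu : Continuous u) (hv : Continuous v) (n : ℤ) :
    angularCoeff (fun θ => u θ - v θ) n = angularCoeff u n - angularCoeff v n := by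
  simp only [angularCoeff, mul_sub]
  rw [intervalIntegral.integral_sub, mul_sub]
  · exact Continuous.intervalIntegrable (by fun_prop) _ _
  · exact Continuous.intervalIntegrable (by fun_prop) _ _

theorem angularCoeff_deriv {u : ℝ → ℂ} (hu : ContDiff ℝ 1 u)
    (hup : Function.Periodic u (2 * π)) (n : ℤ) :
    angularCoeff (deriv u) n = n * Complex.I * angularCoeff u n := by
  have hd : ∀ θ : ℝ, HasDerivAt (fun θ : ℝ => Complex.exp (-(n * θ * Complex.I)))
      (-(n * Complex.I) * Complex.exp (-(n * θ * Complex.I))) θ := by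
    intro θ
    have := (((Complex.ofRealCLM.hasDerivAt (x := θ)).const_mul (n : ℂ)).mul_const
      Complex.I).neg.cexp
    convert! this using 1
    simp [mul_comm]
  have h := intervalIntegral.integral_mul_deriv_eq_deriv_mul (a := 0) (b := 2 * π)
    (fun θ _ => hd θ) (fun θ _ => (hu.differentiable one_ne_zero θ).hasDerivAt)
    (Continuous.intervalIntegrable (by fun_prop) _ _)
    ((hu.continuous_deriv le_rfl).intervalIntegrable _ _)
  have he : Complex.exp (-(n * (2 * π : ℝ) * Complex.I)) = 1 := by
    rw [Complex.exp_eq_one_iff]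
    exact ⟨-n, by push_cast; ring⟩
  have h0 : u (2 * π) = u 0 := by simpa using hup 0
  rw [he, h0] at h
  simp only [mul_assoc (-(n * Complex.I))] at h
  rw [intervalIntegral.integral_const_mul] at h
  rw [angularCoeff, angularCoeff, h]
  simp
  ring

theorem setLIntegral_comp_add_of_periodic {F : ℝ → ENNReal} {T : ℝ} (hT : 0 < T)
    (hF : Function.Periodic F T) (a : ℝ) :
    ∫⁻ σ in Set.Ioc 0 T, F (a + σ) = ∫⁻ σ in Set.Ioc 0 T, F σ := by
  have : Fact (0 < T) := ⟨hT⟩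
  have h0 := AddCircle.lintegral_preimage T 0 hF.lift
  have ha := AddCircle.lintegral_preimage T a hF.lift
  simp only [Function.Periodic.lift_coe, zero_add] at h0 ha
  rw [h0, ← ha]
  have := (measurePreserving_add_left volume a).setLIntegral_comp_preimage_emb
    (measurableEmbedding_addLeft a) F (Set.Ioc a (a + T))
  rw [← this]
  simp

/-- A lower bound for the integral `∫ sin²(nt/2) / sin²(t/2) dt` of the Fejér kernel. -/
theorem ofReal_abs_le_lintegral_fejer (n : ℤ) :
    ENNReal.ofReal |(n : ℝ)| ≤ ∫⁻ t in Set.Ioc 0 (2 * π),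
      ENNReal.ofReal (‖Complex.exp (t * Complex.I) - 1‖ ^ 2)⁻¹ *
        ENNReal.ofReal (‖Complex.exp (n * t * Complex.I) - 1‖ ^ 2) := by
  rcases eq_or_ne n 0 with rfl | hn
  · simp
  have hn' : 1 ≤ |(n : ℝ)| := by exact_mod_cast Int.one_le_abs hn
  set m : ℝ := |(n : ℝ)| with hm
  have hm0 : 0 < m := by linarith
  have hexp (s : ℝ) : ‖Complex.exp (s * Complex.I) - 1‖ = 2 * |sin (s / 2)| := by
    rw [mul_comm, Complex.norm_exp_I_mul_ofReal_sub_one, norm_mul]; simp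
  have hsub : Set.Ioc 0 (π / m) ⊆ Set.Ioc 0 (2 * π) := by
    refine Set.Ioc_subset_Ioc_right ?_
    rw [div_le_iff₀ hm0]
    nlinarith [pi_pos]
  calc ENNReal.ofReal m ≤ ENNReal.ofReal ((2 * m / π) ^ 2 * (π / m)) := by
        apply ENNReal.ofReal_le_ofReal
        have : (2 * m / π) ^ 2 * (π / m) = 4 * m / π := by
          field_simp; norm_num
        rw [this, le_div_iff₀ pi_pos]
        nlinarith [pi_le_four]
    _ = ∫⁻ t in Set.Ioc 0 (π / m), ENNReal.ofReal ((2 * m / π) ^ 2) := by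
        rw [setLIntegral_const, Real.volume_Ioc, sub_zero, ENNReal.ofReal_mul (by positivity)]
    _ ≤ ∫⁻ t in Set.Ioc 0 (π / m), ENNReal.ofReal (‖Complex.exp (t * Complex.I) - 1‖ ^ 2)⁻¹ *
        ENNReal.ofReal (‖Complex.exp (n * t * Complex.I) - 1‖ ^ 2) := by
        refine setLIntegral_mono' measurableSet_Ioc fun t ht => ?_
        rw [← ENNReal.ofReal_mul (by positivity)]
        apply ENNReal.ofReal_le_ofReal
        have ht0 : 0 < t := ht.1
        have htm : m * t ≤ π := by
          have := (le_div_iff₀ hm0).1 ht.2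
          linarith
        have htpi : t ≤ π := by nlinarith
        have hnum : 2 * m * t / π ≤ ‖Complex.exp (n * t * Complex.I) - 1‖ := by
          have h1 : ‖Complex.exp (n * t * Complex.I) - 1‖ = 2 * |sin (m * t / 2)| := by
            have := hexp (n * t)
            push_cast at this
            rw [this, hm]
            rcases abs_choice (n : ℝ) with h | h <;> rw [h]
            rw [neg_mul, neg_div, sin_neg, abs_neg]
          rw [h1]
          have h2 := mul_le_sin (x := m * t / 2) (by positivity) (by linarith)
          have h3 := le_abs_self (sin (m * t / 2))
          calc 2 * m * t / π = 2 * (2 / π * (m * t / 2)) := by ring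
            _ ≤ _ := by linarith
        have hden : ‖Complex.exp (t * Complex.I) - 1‖ ≤ t := by
          rw [mul_comm]
          exact norm_exp_I_mul_ofReal_sub_one_le.trans_eq (by rw [norm_eq_abs, abs_of_pos ht0])
        have hden0 : 0 < ‖Complex.exp (t * Complex.I) - 1‖ := by
          rw [hexp]
          have := sin_pos_of_pos_of_lt_pi (x := t / 2) (by linarith) (by linarith)
          positivity
        rw [inv_mul_eq_div, le_div_iff₀ (by positivity), ← mul_pow]
        refine pow_le_pow_left₀ (by positivity) ?_ 2
        calc 2 * m / π * ‖Complex.exp (t * Complex.I) - 1‖ ≤ 2 * m / π * t := by gcongr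
          _ = 2 * m * t / π := by ring
          _ ≤ _ := hnum
    _ ≤ _ := lintegral_mono_set hsub

theorem douglasEnergyP_eq_lintegral_comp_add {u : ℝ → ℂ} (hu : Continuous u)
    (hup : Function.Periodic u (2 * π)) :
    douglasEnergyP u = ∫⁻ t in Set.Ioc 0 (2 * π),
      ENNReal.ofReal (‖Complex.exp (t * Complex.I) - 1‖ ^ 2)⁻¹ *
        ∫⁻ θ in Set.Ioc 0 (2 * π), ENNReal.ofReal (‖u (θ + t) - u θ‖ ^ 2) := by
  have hker (θ t : ℝ) : ENNReal.ofReal (‖u θ - u (θ + t)‖ ^ 2 /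
      ‖Complex.exp (θ * Complex.I) - Complex.exp ((θ + t : ℝ) * Complex.I)‖ ^ 2) =
      ENNReal.ofReal (‖Complex.exp (t * Complex.I) - 1‖ ^ 2)⁻¹ *
        ENNReal.ofReal (‖u (θ + t) - u θ‖ ^ 2) := by
    have h : Complex.exp ((θ + t : ℝ) * Complex.I) - Complex.exp (θ * Complex.I) =
        Complex.exp (θ * Complex.I) * (Complex.exp (t * Complex.I) - 1) := by
      push_cast
      rw [add_mul, Complex.exp_add]
      ring
    rw [← ENNReal.ofReal_mul (by positivity), norm_sub_rev (u θ), norm_sub_rev (Complex.exp _), h,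
      norm_mul, Complex.norm_exp_ofReal_mul_I, one_mul, inv_mul_eq_div]
  have hinner (θ : ℝ) : ∫⁻ σ in Set.Ioc 0 (2 * π), ENNReal.ofReal
      (‖u θ - u σ‖ ^ 2 / ‖Complex.exp (θ * Complex.I) - Complex.exp (σ * Complex.I)‖ ^ 2) =
      ∫⁻ t in Set.Ioc 0 (2 * π), ENNReal.ofReal (‖Complex.exp (t * Complex.I) - 1‖ ^ 2)⁻¹ *
        ENNReal.ofReal (‖u (θ + t) - u θ‖ ^ 2) := by
    simp only [← hker]
    refine (setLIntegral_comp_add_of_periodic two_pi_pos (fun σ => ?_) θ).symm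
    have h : Complex.exp ((σ + 2 * π : ℝ) * Complex.I) = Complex.exp (σ * Complex.I) := by
      push_cast
      rw [add_mul, Complex.exp_periodic]
    rw [hup σ, h]
  simp only [douglasEnergyP, hinner]
  rw [lintegral_lintegral_swap]
  · exact lintegral_congr fun t => lintegral_const_mul _ (by fun_prop)
  · exact Measurable.aemeasurable (by fun_prop)

/-- The Douglas energy controls the `Ḣ^{1/2}` seminorm given by Fourier coefficients. -/
theorem two_pi_mul_tsum_abs_mul_angularCoeff_sq_le_douglasEnergyP {u : ℝ → ℂ} (hu : Continuous u)
    (hup : Function.Periodic u (2 * π)) :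
    ENNReal.ofReal (2 * π) *
      ∑' n : ℤ, ENNReal.ofReal |(n : ℝ)| * ENNReal.ofReal (‖angularCoeff u n‖ ^ 2) ≤
      douglasEnergyP u := by
  have hpars (t : ℝ) : ∫⁻ θ in Set.Ioc 0 (2 * π), ENNReal.ofReal (‖u (θ + t) - u θ‖ ^ 2) =
      ENNReal.ofReal (2 * π) * ∑' n : ℤ,
        ENNReal.ofReal (‖Complex.exp (n * t * Complex.I) - 1‖ ^ 2) *
          ENNReal.ofReal (‖angularCoeff u n‖ ^ 2) := by
    have h := tsum_ofReal_norm_angularCoeff_sq (u := fun θ => u (θ + t) - u θ) (by fun_prop)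
      (fun θ => by dsimp only; rw [add_right_comm, hup, hup])
    have hn (n : ℤ) : ENNReal.ofReal (‖Complex.exp (n * t * Complex.I) - 1‖ ^ 2) *
        ENNReal.ofReal (‖angularCoeff u n‖ ^ 2) =
        ENNReal.ofReal (‖angularCoeff (fun θ => u (θ + t) - u θ) n‖ ^ 2) := by
      rw [angularCoeff_sub (u := fun θ => u (θ + t)) (by fun_prop) hu, angularCoeff_comp_add hup,
        ← sub_one_mul, norm_mul, mul_pow, ENNReal.ofReal_mul (by positivity)]
    simp only [hn]
    rw [h, ← mul_assoc, ← ENNReal.ofReal_mul two_pi_pos.le, mul_inv_cancel₀ two_pi_pos.ne',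
      ENNReal.ofReal_one, one_mul]
  rw [douglasEnergyP_eq_lintegral_comp_add hu hup]
  simp only [hpars, mul_left_comm _ (ENNReal.ofReal (2 * π)), ← ENNReal.tsum_mul_left, ← mul_assoc]
  rw [lintegral_tsum fun n => Measurable.aemeasurable (by fun_prop)]
  refine ENNReal.tsum_le_tsum fun n => ?_
  simp only [mul_assoc (ENNReal.ofReal (2 * π))]
  rw [lintegral_const_mul _ (by fun_prop), lintegral_mul_const _ (by fun_prop)]
  gcongr
  exact ofReal_abs_le_lintegral_fejer n

/-- The Cauchy–Schwarz inequality for sums in `[0, ∞]`. -/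
theorem ENNReal.tsum_mul_le_rpow_half_mul_rpow_half {ι : Type*} (a b : ι → ENNReal) :
    ∑' i, a i * b i ≤ (∑' i, a i ^ 2) ^ ((1 : ℝ) / 2) * (∑' i, b i ^ 2) ^ ((1 : ℝ) / 2) := by
  let _ : MeasurableSpace ι := ⊤
  have h := ENNReal.lintegral_mul_le_Lp_mul_Lq Measure.count Real.HolderConjugate.two_two
    (f := a) (g := b) measurable_from_top.aemeasurable measurable_from_top.aemeasurable
  simpa [lintegral_count] using h

theorem douglasEnergyP_conj (u : ℝ → ℂ) :
    douglasEnergyP (fun θ => conj (u θ)) = douglasEnergyP u := by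
  simp only [douglasEnergyP, ← map_sub, RCLike.norm_conj]

theorem symplectic_pairing_bounded_by_douglas_energy :
    ∃ C : ℝ, 0 < C ∧ ∀ f g : ℝ → ℂ, ContDiff ℝ 1 f → ContDiff ℝ 1 g →
      (∀ θ, f (θ + 2 * π) = f θ) → (∀ θ, g (θ + 2 * π) = g θ) →
      ENNReal.ofReal ‖∫ θ in (0 : ℝ)..(2 * π), f θ * deriv g θ‖ ≤
        ENNReal.ofReal C * douglasEnergyP f ^ ((1 : ℝ) / 2) *
          douglasEnergyP g ^ ((1 : ℝ) / 2) := by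
  refine ⟨1, one_pos, fun f g hf hg hfp hgp => ?_⟩
  rw [ENNReal.ofReal_one, one_mul, ← douglasEnergyP_conj f]
  set φ : ℝ → ℂ := fun θ => conj (f θ) with hφ
  have hφc : Continuous φ := Complex.continuous_conj.comp hf.continuous
  have hφp : Function.Periodic φ (2 * π) := fun θ => by simp only [hφ, hfp θ]
  have hgp' : Function.Periodic (deriv g) (2 * π) := fun θ => by
    rw [← deriv_comp_add_const, funext hgp]
  have hsum := (hasSum_conj_angularCoeff_mul hφc (hg.continuous_deriv le_rfl) hφp hgp').tsum_eq
  simp only [hφ, Complex.conj_conj] at hsum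
  have hpi : (2 * π : ℂ) ≠ 0 := by exact_mod_cast two_pi_pos.ne'
  rw [eq_inv_mul_iff_mul_eq₀ hpi] at hsum
  have hS := two_pi_mul_tsum_abs_mul_angularCoeff_sq_le_douglasEnergyP hφc hφp
  have hT := two_pi_mul_tsum_abs_mul_angularCoeff_sq_le_douglasEnergyP hg.continuous hgp
  have hsq (u : ℝ → ℂ) (n : ℤ) :
      ENNReal.ofReal (√|(n : ℝ)| * ‖angularCoeff u n‖) ^ 2 =
        ENNReal.ofReal |(n : ℝ)| * ENNReal.ofReal (‖angularCoeff u n‖ ^ 2) := by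
    rw [← ENNReal.ofReal_pow (by positivity), mul_pow, sq_sqrt (abs_nonneg _),
      ENNReal.ofReal_mul (abs_nonneg _)]
  calc ENNReal.ofReal ‖∫ θ in (0 : ℝ)..(2 * π), f θ * deriv g θ‖
      ≤ ENNReal.ofReal (2 * π) * ∑' n : ℤ, ENNReal.ofReal (√|(n : ℝ)| * ‖angularCoeff φ n‖) *
          ENNReal.ofReal (√|(n : ℝ)| * ‖angularCoeff g n‖) := by
        rw [← hsum, norm_mul, ENNReal.ofReal_mul (norm_nonneg _)]
        gcongr
        · simp [abs_of_pos pi_pos]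
        · rw [ofReal_norm]
          refine enorm_tsum_le_tsum_enorm.trans (ENNReal.tsum_le_tsum fun n => le_of_eq ?_)
          rw [angularCoeff_deriv hg hgp, ← ENNReal.ofReal_mul (by positivity), ← ofReal_norm]
          congr 1
          simp only [norm_mul, RCLike.norm_conj, Complex.norm_I, Complex.norm_intCast, mul_one]
          rw [mul_mul_mul_comm, mul_self_sqrt (abs_nonneg _)]
          ring
    _ ≤ ENNReal.ofReal (2 * π) *
        ((∑' n : ℤ, ENNReal.ofReal |(n : ℝ)| * ENNReal.ofReal (‖angularCoeff φ n‖ ^ 2)) ^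
            ((1 : ℝ) / 2) *
          (∑' n : ℤ, ENNReal.ofReal |(n : ℝ)| * ENNReal.ofReal (‖angularCoeff g n‖ ^ 2)) ^
            ((1 : ℝ) / 2)) := by
        gcongr
        simpa only [hsq] using ENNReal.tsum_mul_le_rpow_half_mul_rpow_half
          (fun n : ℤ => ENNReal.ofReal (√|(n : ℝ)| * ‖angularCoeff φ n‖))
          (fun n : ℤ => ENNReal.ofReal (√|(n : ℝ)| * ‖angularCoeff g n‖))
    _ = (ENNReal.ofReal (2 * π) *
          ∑' n : ℤ, ENNReal.ofReal |(n : ℝ)| * ENNReal.ofReal (‖angularCoeff φ n‖ ^ 2)) ^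
            ((1 : ℝ) / 2) *
        (ENNReal.ofReal (2 * π) *
          ∑' n : ℤ, ENNReal.ofReal |(n : ℝ)| * ENNReal.ofReal (‖angularCoeff g n‖ ^ 2)) ^
            ((1 : ℝ) / 2) := by
        rw [ENNReal.mul_rpow_of_nonneg _ _ (by norm_num), ENNReal.mul_rpow_of_nonneg _ _ (by norm_num),
          mul_mul_mul_comm, ← ENNReal.rpow_add_of_nonneg _ _ (by norm_num) (by norm_num),
          add_halves, ENNReal.rpow_one]
    _ ≤ _ := by gcongr
end
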